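/- arXiv:1909.03962 — 8 statements merged into one kernel-verified Lean document; each statement's English description precedes it below -/
import Mathlib

section
/- The fibres of the Hopf moment map over nonzero points are exactly the orbits of left multiplication by unit complex numbers: for nonzero quaternions q, q′, one has μ(q) = μ(q′) if and only if there exists θ ∈ ℝ with q′ = (cos θ + sin θ·i)·q. (Hence μ induces a bijection (ℍ∖{0})/U(1) ≅ Im ℍ∖{0}.) -/
noncomputable section

/-- The imaginary unit `i` in the real quaternions. -/
def qI : Quaternion ℝ := ⟨0, 1, 0, 0⟩

/-- The Hopf moment map `μ(q) = (1/2)·(conj q)·i·q`. -/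
def hopfMu (q : Quaternion ℝ) : Quaternion ℝ := (1 / 2 : ℝ) • (star q * qI * q)

/-- The unit complex number `cos θ + sin θ·i`, viewed as a quaternion. -/
def unitC (θ : ℝ) : Quaternion ℝ := ⟨Real.cos θ, Real.sin θ, 0, 0⟩

@[simp] theorem qI_re  : (qI).re = 0 := rfl
@[simp] theorem qI_imI  : (qI).imI = 1 := rfl
@[simp] theorem qI_imJ  : (qI).imJ = 0 := rfl
@[simp] theorem qI_imK  : (qI).imK = 0 := rfl
@[simp] theorem unitC_re (θ : ℝ) : (unitC θ).re = Real.cos θ := rfl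
@[simp] theorem unitC_imI (θ : ℝ) : (unitC θ).imI = Real.sin θ := rfl
@[simp] theorem unitC_imJ (θ : ℝ) : (unitC θ).imJ = 0 := rfl
@[simp] theorem unitC_imK (θ : ℝ) : (unitC θ).imK = 0 := rfl

theorem unitC_conj (θ : ℝ) : star (unitC θ) * qI * unitC θ = qI := by
  have h := Real.sin_sq_add_cos_sq θ
  ext <;> simp <;> nlinarith

theorem exists_angle (a b : ℝ) (h : a ^ 2 + b ^ 2 = 1) :
    ∃ θ : ℝ, Real.cos θ = a ∧ Real.sin θ = b := by
  have hn : ‖(⟨a, b⟩ : ℂ)‖ = 1 := by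
    rw [Complex.norm_def, Complex.normSq_mk, Real.sqrt_eq_one]; linarith
  have h0 : (⟨a, b⟩ : ℂ) ≠ 0 := by
    intro h0; rw [h0] at hn; simp at hn
  refine ⟨Complex.arg ⟨a, b⟩, ?_, ?_⟩
  · rw [Complex.cos_arg h0, hn]; simp
  · rw [Complex.sin_arg, hn]; simp

theorem exists_unitC (u : Quaternion ℝ) (hn : Quaternion.normSq u = 1)
    (h : star u * qI * u = qI) : ∃ θ : ℝ, u = unitC θ := by
  have hc : qI * u = u * qI := by
    calc qI * u = (u * star u) * (qI * u) := by
          rw [Quaternion.self_mul_star, hn]; simp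
      _ = u * (star u * qI * u) := by simp only [mul_assoc]
      _ = u * qI := by rw [h]
  have hJ := congrArg (fun x : Quaternion ℝ => x.imJ) hc
  have hK := congrArg (fun x : Quaternion ℝ => x.imK) hc
  simp at hJ hK
  have hJ0 : u.imJ = 0 := by linarith
  have hK0 : u.imK = 0 := by linarith
  rw [Quaternion.normSq_def', hJ0, hK0] at hn
  obtain ⟨θ, h1, h2⟩ := exists_angle u.re u.imI (by linarith)
  refine ⟨θ, ?_⟩
  ext <;> simp [h1, h2, hJ0, hK0]

/-- The fibres of the Hopf moment map over nonzero points are exactly the orbits of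
left multiplication by unit complex numbers: for nonzero quaternions `q`, `q′`,
`μ(q) = μ(q′)` iff there is `θ ∈ ℝ` with `q′ = (cos θ + sin θ·i)·q`. -/
theorem hopfMu_fibres (q q' : Quaternion ℝ) (hq : q ≠ 0) (hq' : q' ≠ 0) :
    hopfMu q = hopfMu q' ↔ ∃ θ : ℝ, q' = unitC θ * q := by
  constructor
  · intro h
    have h1 : star q * qI * q = star q' * qI * q' :=
      smul_right_injective _ (by norm_num : (1 / 2 : ℝ) ≠ 0) h
    have hI : Quaternion.normSq qI = 1 := by simp [Quaternion.normSq_def']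
    have h2 := congrArg Quaternion.normSq h1
    simp only [map_mul, Quaternion.normSq_star, hI, mul_one] at h2
    have h3 : Quaternion.normSq q = Quaternion.normSq q' :=
      (mul_self_inj Quaternion.normSq_nonneg Quaternion.normSq_nonneg).1 h2
    have hs : star q ≠ 0 := star_ne_zero.2 hq
    have hu : q' * q⁻¹ * q = q' := inv_mul_cancel_right₀ hq q'
    obtain ⟨θ, hθ⟩ := exists_unitC (q' * q⁻¹)
      (by
        rw [map_mul, map_inv₀, ← h3]
        exact mul_inv_cancel₀ (Quaternion.normSq_ne_zero.2 hq))
      (by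
        apply mul_right_cancel₀ hq
        apply mul_left_cancel₀ hs
        calc star q * (star (q' * q⁻¹) * qI * (q' * q⁻¹) * q)
            = star (q' * q⁻¹ * q) * qI * (q' * q⁻¹ * q) := by
              rw [star_mul (q' * q⁻¹) q]; simp only [mul_assoc]
          _ = star q * (qI * q) := by rw [hu, ← h1, mul_assoc])
    exact ⟨θ, by rw [← hθ, hu]⟩
  · rintro ⟨θ, rfl⟩
    unfold hopfMu
    have : star (unitC θ * q) * qI * (unitC θ * q)
        = star q * (star (unitC θ) * qI * unitC θ) * q := by
      rw [star_mul]; simp only [mul_assoc]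
    rw [this, unitC_conj]
end
end

section
/- The Hopf moment map satisfies the hyperKähler moment map property with respect to the Killing field X: at every point of ℝ⁴, the contraction of γ_i with X equals the differential of μ_i, i.e. ι_{X(q)} γ₁ = (dμ₁)_q, ι_{X(q)} γ₂ = (dμ₂)_q, and ι_{X(q)} γ₃ = (dμ₃)_q for all q ∈ ℝ⁴. -/
noncomputable section

/-- The components `μ₁, μ₂, μ₃` of the Hopf moment map along `i`, `j`, `k`. -/
def mu1 (q : Quaternion ℝ) : ℝ := (hopfMu q).imI
def mu2 (q : Quaternion ℝ) : ℝ := (hopfMu q).imJ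
def mu3 (q : Quaternion ℝ) : ℝ := (hopfMu q).imK

/-- Coordinates on `ℝ⁴ ≅ ℍ` via `(x₁,x₂,x₃,x₄) ↦ x₁ + x₂·i + x₃·j − x₄·k`:
the dual standard basis `dx₁, dx₂, dx₃, dx₄`. -/
def dx1 (v : Quaternion ℝ) : ℝ := v.re
def dx2 (v : Quaternion ℝ) : ℝ := v.imI
def dx3 (v : Quaternion ℝ) : ℝ := v.imJ
def dx4 (v : Quaternion ℝ) : ℝ := -v.imK

/-- `γ₁ = dx₁∧dx₂ + dx₃∧dx₄`. -/
def gamma1 (v w : Quaternion ℝ) : ℝ :=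
  (dx1 v * dx2 w - dx2 v * dx1 w) + (dx3 v * dx4 w - dx4 v * dx3 w)

/-- `γ₂ = dx₁∧dx₃ + dx₄∧dx₂`. -/
def gamma2 (v w : Quaternion ℝ) : ℝ :=
  (dx1 v * dx3 w - dx3 v * dx1 w) + (dx4 v * dx2 w - dx2 v * dx4 w)

/-- `γ₃ = −dx₁∧dx₄ − dx₂∧dx₃`. -/
def gamma3 (v w : Quaternion ℝ) : ℝ :=
  -(dx1 v * dx4 w - dx4 v * dx1 w) - (dx2 v * dx3 w - dx3 v * dx2 w)

/-- The Killing vector field `X(q) = −i·q` generating the circle action. -/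
def hopfX (q : Quaternion ℝ) : Quaternion ℝ := -(qI * q)

/-- Coordinate projections as continuous linear maps. -/
def cRe : Quaternion ℝ →L[ℝ] ℝ :=
  LinearMap.toContinuousLinearMap
    { toFun := fun q => q.re, map_add' := fun _ _ => by simp, map_smul' := fun _ _ => by simp }
def cI : Quaternion ℝ →L[ℝ] ℝ :=
  LinearMap.toContinuousLinearMap
    { toFun := fun q => q.imI, map_add' := fun _ _ => by simp, map_smul' := fun _ _ => by simp }
def cJ : Quaternion ℝ →L[ℝ] ℝ :=
  LinearMap.toContinuousLinearMap
    { toFun := fun q => q.imJ, map_add' := fun _ _ => by simp, map_smul' := fun _ _ => by simp }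
def cK : Quaternion ℝ →L[ℝ] ℝ :=
  LinearMap.toContinuousLinearMap
    { toFun := fun q => q.imK, map_add' := fun _ _ => by simp, map_smul' := fun _ _ => by simp }

lemma cRe_apply (q : Quaternion ℝ) : cRe q = q.re := rfl
lemma cI_apply (q : Quaternion ℝ) : cI q = q.imI := rfl
lemma cJ_apply (q : Quaternion ℝ) : cJ q = q.imJ := rfl
lemma cK_apply (q : Quaternion ℝ) : cK q = q.imK := rfl

lemma qI_re_s6 : qI.re = 0 := rfl
lemma qI_imI_s6 : qI.imI = 1 := rfl
lemma qI_imJ_s6 : qI.imJ = 0 := rfl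
lemma qI_imK_s6 : qI.imK = 0 := rfl

lemma mu1_eq : mu1 = fun q => (1 / 2 : ℝ) * (cRe q * cRe q + cI q * cI q - cJ q * cJ q - cK q * cK q) := by
  funext q
  simp [mu1, hopfMu, qI_re_s6, qI_imI_s6, qI_imJ_s6, qI_imK_s6, cRe_apply, cI_apply, cJ_apply, cK_apply]
  ring

lemma mu2_eq : mu2 = fun q => cI q * cJ q - cRe q * cK q := by
  funext q
  simp [mu2, hopfMu, qI_re_s6, qI_imI_s6, qI_imJ_s6, qI_imK_s6, cRe_apply, cI_apply, cJ_apply, cK_apply]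
  ring

lemma mu3_eq : mu3 = fun q => cI q * cK q + cRe q * cJ q := by
  funext q
  simp [mu3, hopfMu, qI_re_s6, qI_imI_s6, qI_imJ_s6, qI_imK_s6, cRe_apply, cI_apply, cJ_apply, cK_apply]
  ring

/-- The hyperKähler moment map property `ι_{X(q)} γ_i = (dμ_i)_q` for `i = 1, 2, 3`,
where `dμ_i` is the Fréchet differential of `μ_i`. -/
theorem hopfMu_moment_map_property (q v : Quaternion ℝ) :
    gamma1 (hopfX q) v = fderiv ℝ mu1 q v ∧
    gamma2 (hopfX q) v = fderiv ℝ mu2 q v ∧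
    gamma3 (hopfX q) v = fderiv ℝ mu3 q v := by
  have h0 := cRe.hasFDerivAt (x := q)
  have h1 := cI.hasFDerivAt (x := q)
  have h2 := cJ.hasFDerivAt (x := q)
  have h3 := cK.hasFDerivAt (x := q)
  refine ⟨?_, ?_, ?_⟩
  · have h := ((((h0.mul h0).add (h1.mul h1)).sub (h2.mul h2)).sub (h3.mul h3)).const_mul (1 / 2 : ℝ)
    have e := HasFDerivAt.fderiv (f := mu1) (by rw [mu1_eq]; exact h)
    rw [e]
    simp [gamma1, dx1, dx2, dx3, dx4, hopfX, qI_re_s6, qI_imI_s6, qI_imJ_s6, qI_imK_s6, cRe_apply, cI_apply, cJ_apply, cK_apply]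
    ring
  · have h := (h1.mul h2).sub (h0.mul h3)
    have e := HasFDerivAt.fderiv (f := mu2) (by rw [mu2_eq]; exact h)
    rw [e]
    simp [gamma2, dx1, dx2, dx3, dx4, hopfX, qI_re_s6, qI_imI_s6, qI_imJ_s6, qI_imK_s6, cRe_apply, cI_apply, cJ_apply, cK_apply]
    ring
  · have h := (h1.mul h3).add (h0.mul h2)
    have e := HasFDerivAt.fderiv (f := mu3) (by rw [mu3_eq]; exact h)
    rw [e]
    simp [gamma3, dx1, dx2, dx3, dx4, hopfX, qI_re_s6, qI_imI_s6, qI_imJ_s6, qI_imK_s6, cRe_apply, cI_apply, cJ_apply, cK_apply]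
    ring
end
end

section
/- The flat metric on ℝ⁴ is reconstructed from the Gibbons–Hawking data of the Hopf fibration: for every nonzero q ∈ ℝ⁴ and all v, w ∈ ℝ⁴, ⟨v,w⟩ = ‖q‖²·η_q(v)·η_q(w) + ‖q‖⁻²·⟨Dμ_q(v), Dμ_q(w)⟩, where Dμ_q is the Fréchet derivative of μ at q. (This is the identity g_{ℝ⁴} = f⁻¹ η⊗η + f μ*g₀ with harmonic function f(u) = 1/(2‖u‖), since f(μ(q)) = ‖q‖⁻².) -/
noncomputable section

/-- The standard Euclidean inner product on `ℝ⁴ ≅ ℍ`. -/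
def dotQ (v w : Quaternion ℝ) : ℝ :=
  v.re * w.re + v.imI * w.imI + v.imJ * w.imJ + v.imK * w.imK

/-- The connection 1-form `η_q = ‖q‖⁻²(x₂dx₁ − x₁dx₂ − x₄dx₃ + x₃dx₄)`. -/
def eta (q v : Quaternion ℝ) : ℝ :=
  (‖q‖ ^ 2)⁻¹ * (dx2 q * dx1 v - dx1 q * dx2 v - dx4 q * dx3 v + dx3 q * dx4 v)

/-- Quaternion conjugation as a continuous real-linear map. -/
def quatStar : Quaternion ℝ →L[ℝ] Quaternion ℝ :=
  LinearMap.mkContinuous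
    { toFun := fun q => star q
      map_add' := fun a b => star_add a b
      map_smul' := fun r a => Quaternion.star_smul r a } 1
    (fun a => by rw [one_mul]; exact le_of_eq (Quaternion.norm_star a))

theorem hopfMu_fderiv (q v : Quaternion ℝ) :
    fderiv ℝ hopfMu q v = (1 / 2 : ℝ) • (star q * qI * v + star v * qI * q) := by
  have h1 : HasFDerivAt (fun q : Quaternion ℝ => star q) quatStar q := quatStar.hasFDerivAt
  have h2 := (((h1.mul_const' qI).mul' (hasFDerivAt_id q)).const_smul (1 / 2 : ℝ))
  have h3 : HasFDerivAt hopfMu _ q := h2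
  rw [h3.fderiv]
  change (1 / 2 : ℝ) • (star q * qI * v + (star v * qI) * q) = _
  rfl

theorem hopfMu_fderiv_coord (q v : Quaternion ℝ) :
    fderiv ℝ hopfMu q v = ⟨0,
      q.re * v.re + q.imI * v.imI - q.imJ * v.imJ - q.imK * v.imK,
      -(q.re * v.imK) + q.imI * v.imJ + q.imJ * v.imI - q.imK * v.re,
      q.re * v.imJ + q.imI * v.imK + q.imJ * v.re + q.imK * v.imI⟩ := by
  rw [hopfMu_fderiv]
  have e1 : qI.re = 0 := rfl
  have e2 : qI.imI = 1 := rfl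
  have e3 : qI.imJ = 0 := rfl
  have e4 : qI.imK = 0 := rfl
  ext <;>
  simp only [e1, e2, e3, e4, Quaternion.re_smul, Quaternion.imI_smul, Quaternion.imJ_smul,
    Quaternion.imK_smul, Quaternion.re_add, Quaternion.imI_add, Quaternion.imJ_add,
    Quaternion.imK_add, Quaternion.re_mul, Quaternion.imI_mul, Quaternion.imJ_mul,
    Quaternion.imK_mul, Quaternion.re_star, Quaternion.imI_star, Quaternion.imJ_star,
    Quaternion.imK_star, smul_eq_mul] <;>
  ring

/-- The flat metric on `ℝ⁴` is reconstructed from the Gibbons–Hawking data of the Hopf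
fibration: for every nonzero `q` and all `v, w`,
`⟨v,w⟩ = ‖q‖²·η_q(v)·η_q(w) + ‖q‖⁻²·⟨Dμ_q(v), Dμ_q(w)⟩`, where `Dμ_q` is the Fréchet
derivative of `μ` at `q`. -/
theorem flat_metric_gibbons_hawking (q : Quaternion ℝ) (hq : q ≠ 0)
    (v w : Quaternion ℝ) :
    dotQ v w = ‖q‖ ^ 2 * eta q v * eta q w +
      (‖q‖ ^ 2)⁻¹ * dotQ (fderiv ℝ hopfMu q v) (fderiv ℝ hopfMu q w) := by
  have hN : ‖q‖ ^ 2 ≠ 0 := pow_ne_zero 2 (norm_ne_zero_iff.mpr hq)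
  have hS : ‖q‖ ^ 2 = q.re ^ 2 + q.imI ^ 2 + q.imJ ^ 2 + q.imK ^ 2 := by
    rw [pow_two, ← Quaternion.normSq_eq_norm_mul_self, Quaternion.normSq_def']
  have hA : ∀ u, eta q u = (‖q‖ ^ 2)⁻¹ *
      (q.imI * u.re - q.re * u.imI + q.imK * u.imJ - q.imJ * u.imK) := by
    intro u
    simp only [eta, dx1, dx2, dx3, dx4]
    ring
  rw [hA, hA, hopfMu_fderiv_coord, hopfMu_fderiv_coord]
  generalize ‖q‖ ^ 2 = N at *
  simp only [dotQ]
  field_simp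
  rw [hS]
  ring
end
end

section
/- The connection form η of the Hopf fibration satisfies the Gibbons–Hawking monopole equation dη = μ*(*_{ℝ³} df) for the harmonic function f(u) = 1/(2‖u‖): for every nonzero q ∈ ℝ⁴ and all v, w ∈ ℝ⁴, (Dη)_q(v)(w) − (Dη)_q(w)(v) = ⟨(∇f)(μ(q)), Dμ_q(v) × Dμ_q(w)⟩, where (∇f)(u) = −u/(2‖u‖³), Dμ_q is the Fréchet derivative of μ at q, × is the cross product onIm ℍ ≅ ℝ³, and the left-hand side is the exterior derivative dη evaluated on (v,w). -/
noncomputable section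

/-- The cross product on `Im ℍ ≅ ℝ³`, taken with respect to the ordered orthonormal
basis `i, j, k`. -/
def crossQ (v w : Quaternion ℝ) : Quaternion ℝ :=
  ⟨0, v.imJ * w.imK - v.imK * w.imJ, v.imK * w.imI - v.imI * w.imK,
    v.imI * w.imJ - v.imJ * w.imI⟩

/-- The gradient `∇f(u) = −u/(2‖u‖³)` of the harmonic function `f(u) = 1/(2‖u‖)`. -/
def gradf (u : Quaternion ℝ) : Quaternion ℝ := -(2 * ‖u‖ ^ 3)⁻¹ • u

/-- numerator of eta as a linear map in the base point -/
def numL (w : Quaternion ℝ) : Quaternion ℝ →ₗ[ℝ] ℝ where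
  toFun p := dx2 p * dx1 w - dx1 p * dx2 w - dx4 p * dx3 w + dx3 p * dx4 w
  map_add' x y := by simp [dx1, dx2, dx3, dx4]; ring
  map_smul' c x := by simp [dx1, dx2, dx3, dx4]; ring

lemma normsq_eq (q : Quaternion ℝ) :
    ‖q‖ ^ 2 = q.re ^ 2 + q.imI ^ 2 + q.imJ ^ 2 + q.imK ^ 2 := by
  rw [sq, ← Quaternion.normSq_eq_norm_mul_self, Quaternion.normSq_def']

lemma fderiv_eta (q : Quaternion ℝ) (hq : q ≠ 0) (v w : Quaternion ℝ) :
    fderiv ℝ (fun p => eta p w) q v =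
      (‖q‖ ^ 2)⁻¹ * numL w v - 2 * inner ℝ q v * ((‖q‖ ^ 2)⁻¹) ^ 2 * numL w q := by
  have hn : ‖q‖ ^ 2 ≠ 0 := by simpa using hq
  have h1 : HasFDerivAt (fun p : Quaternion ℝ => ‖p‖ ^ 2) _ q :=
    (hasStrictFDerivAt_norm_sq q).hasFDerivAt
  have h2 := (hasDerivAt_inv hn).comp_hasFDerivAt q h1
  have h3 : HasFDerivAt (fun p => numL w p) _ q :=
    (LinearMap.toContinuousLinearMap (numL w)).hasFDerivAt
  have h4 := h2.mul h3
  have h5 : HasFDerivAt (fun p => eta p w) _ q := h4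
  rw [h5.fderiv]
  simp
  ring

/-- quaternion conjugation as a linear map -/
def starLin : Quaternion ℝ →ₗ[ℝ] Quaternion ℝ where
  toFun p := star p
  map_add' x y := star_add x y
  map_smul' c x := by ext <;> simp

lemma fderiv_mu (q v : Quaternion ℝ) :
    fderiv ℝ hopfMu q v = (1 / 2 : ℝ) • (star v * qI * q + star q * qI * v) := by
  have h0 : HasFDerivAt (fun p : Quaternion ℝ => star p) _ q :=
    (LinearMap.toContinuousLinearMap starLin).hasFDerivAt
  have h1 := ((h0.mul_const' qI).mul' (hasFDerivAt_id q)).const_smul (1 / 2 : ℝ)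
  have h5 : HasFDerivAt hopfMu _ q := h1
  rw [h5.fderiv]
  simp [add_comm, starLin]

lemma norm_mu (q : Quaternion ℝ) : ‖hopfMu q‖ = ‖q‖ ^ 2 / 2 := by
  have : ‖qI‖ = 1 := by
    have := normsq_eq qI
    have h : ‖qI‖ ^ 2 = 1 := by rw [this]; simp [qI]
    nlinarith [norm_nonneg qI]
  simp [hopfMu, norm_smul, this]
  ring

theorem eta_monopole_equation (q : Quaternion ℝ) (hq : q ≠ 0) (v w : Quaternion ℝ) :
    fderiv ℝ (fun p => eta p w) q v - fderiv ℝ (fun p => eta p v) q w =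
      dotQ (gradf (hopfMu q)) (crossQ (fderiv ℝ hopfMu q v) (fderiv ℝ hopfMu q w)) := by
  have hn : ‖q‖ ^ 2 ≠ 0 := by simpa using hq
  rw [fderiv_eta q hq, fderiv_eta q hq, fderiv_mu, fderiv_mu, gradf, norm_mu]
  have hN := normsq_eq q
  generalize ‖q‖ ^ 2 = N at *
  simp only [Quaternion.inner_def, numL, LinearMap.coe_mk, AddHom.coe_mk, dotQ, crossQ, hopfMu,
    dx1, dx2, dx3, dx4]
  have i0 : qI.re = 0 := rfl
  have i1 : qI.imI = 1 := rfl
  have i2 : qI.imJ = 0 := rfl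
  have i3 : qI.imK = 0 := rfl
  simp only [i0, i1, i2, i3, mul_zero, mul_one, zero_add, add_zero, sub_zero, zero_sub, neg_neg,
    Quaternion.re_mul, Quaternion.imI_mul, Quaternion.imJ_mul, Quaternion.imK_mul,
    Quaternion.re_star, Quaternion.imI_star, Quaternion.imJ_star, Quaternion.imK_star,
    Quaternion.re_smul, Quaternion.imI_smul, Quaternion.imJ_smul, Quaternion.imK_smul,
    Quaternion.re_add, Quaternion.imI_add, Quaternion.imJ_add, Quaternion.imK_add, smul_eq_mul]
  have hM : N⁻¹ * N = 1 := inv_mul_cancel₀ hn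
  have h3 : (2 * (N / 2) ^ 3)⁻¹ = 4 * N⁻¹ ^ 3 := by field_simp; norm_num
  rw [h3]
  generalize N⁻¹ = M at *
  clear h3 hn hq
  obtain ⟨a, b, c, d⟩ := q
  obtain ⟨v0, v1, v2, v3⟩ := v
  obtain ⟨w0, w1, w2, w3⟩ := w
  simp only at *
  have e1 : M = M ^ 3 * N ^ 2 := by linear_combination -(M * N + 1) * M * hM
  have e2 : M ^ 2 = M ^ 3 * N := by linear_combination -M ^ 2 * hM
  rw [e2]
  have e4 : ∀ x y : ℝ, M * x = M ^ 3 * N ^ 2 * x := fun x _ => by rw [← e1]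
  rw [e4 _ 0, e4 _ 0]
  clear e1 e2 e4 hM
  generalize M ^ 3 = K
  subst hN
  ring
end
end

section
/- For every nonzero q ∈ ℝ⁴, the contraction of the standard volume form of ℝ⁴ with the Hopf vector field equals minus ‖q‖⁻² times the wedge of the differentials of the moment map components: ι_{X(q)}(dx₁∧dx₂∧dx₃∧dx₄) = −‖q‖⁻²·(dμ₁)_q ∧ (dμ₂)_q ∧ (dμ₃)_q. -/
noncomputable section

/-- The standard volume form `dx₁∧dx₂∧dx₃∧dx₄` of `ℝ⁴ ≅ ℍ`. -/
def vol4 (v0 v1 v2 v3 : Quaternion ℝ) : ℝ :=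
  Matrix.det !![dx1 v0, dx1 v1, dx1 v2, dx1 v3;
                dx2 v0, dx2 v1, dx2 v2, dx2 v3;
                dx3 v0, dx3 v1, dx3 v2, dx3 v3;
                dx4 v0, dx4 v1, dx4 v2, dx4 v3]

/-- Differential of a linear functional of the moment map. -/
lemma fderiv_lin_hopf (f : Quaternion ℝ →ₗ[ℝ] ℝ) (q v : Quaternion ℝ) :
    fderiv ℝ (fun q => f (hopfMu q)) q v
      = f ((1 / 2 : ℝ) • (star q * qI * v + star v * qI * q)) := by
  let S : Quaternion ℝ →ₗ[ℝ] Quaternion ℝ :=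
    { toFun := fun q => star q
      map_add' := fun x y => star_add x y
      map_smul' := fun c x => Quaternion.star_smul c x }
  have hs : HasFDerivAt (fun q : Quaternion ℝ => star q)
      (LinearMap.toContinuousLinearMap S) q :=
    (LinearMap.toContinuousLinearMap S).hasFDerivAt
  have h1 := (((hs.mul_const' qI).mul' (hasFDerivAt_id q)).const_smul (1 / 2 : ℝ))
  have h2 := (LinearMap.toContinuousLinearMap f).hasFDerivAt.comp q h1
  have h3 : HasFDerivAt (fun q => f (hopfMu q)) _ q := h2
  rw [h3.fderiv]
  change f ((1 / 2 : ℝ) • (star q * qI * v + star v * qI * q)) = _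
  rfl

/-- For every nonzero `q`, the contraction of the standard volume form of `ℝ⁴` with the
Hopf vector field equals `−‖q‖⁻²` times the wedge of the differentials of the moment
map components: `ι_{X(q)}(dx₁∧dx₂∧dx₃∧dx₄) = −‖q‖⁻²·dμ₁ ∧ dμ₂ ∧ dμ₃` at `q`. -/
theorem contraction_volume_hopf (q : Quaternion ℝ) (hq : q ≠ 0)
    (v1 v2 v3 : Quaternion ℝ) :
    vol4 (hopfX q) v1 v2 v3 =
      -(‖q‖ ^ 2)⁻¹ *
        Matrix.det !![fderiv ℝ mu1 q v1, fderiv ℝ mu1 q v2, fderiv ℝ mu1 q v3;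
                      fderiv ℝ mu2 q v1, fderiv ℝ mu2 q v2, fderiv ℝ mu2 q v3;
                      fderiv ℝ mu3 q v1, fderiv ℝ mu3 q v2, fderiv ℝ mu3 q v3] := by
  have e1 : ∀ v, fderiv ℝ mu1 q v = ((1 / 2 : ℝ) • (star q * qI * v + star v * qI * q)).imI := fun v =>
    fderiv_lin_hopf (QuaternionAlgebra.imIₗ (-1) 0 (-1)) q v
  have e2 : ∀ v, fderiv ℝ mu2 q v = ((1 / 2 : ℝ) • (star q * qI * v + star v * qI * q)).imJ := fun v =>
    fderiv_lin_hopf (QuaternionAlgebra.imJₗ (-1) 0 (-1)) q v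
  have e3 : ∀ v, fderiv ℝ mu3 q v = ((1 / 2 : ℝ) • (star q * qI * v + star v * qI * q)).imK := fun v =>
    fderiv_lin_hopf (QuaternionAlgebra.imKₗ (-1) 0 (-1)) q v
  have i0 : qI.re = 0 := rfl
  have i1 : qI.imI = 1 := rfl
  have i2 : qI.imJ = 0 := rfl
  have i3 : qI.imK = 0 := rfl
  have hn : ‖q‖ ^ 2 = q.re ^ 2 + q.imI ^ 2 + q.imJ ^ 2 + q.imK ^ 2 := by
    rw [sq, ← Quaternion.normSq_eq_norm_mul_self, Quaternion.normSq_def']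
  have h0 : ‖q‖ ^ 2 ≠ 0 := by simpa using hq
  have key : ‖q‖ ^ 2 * vol4 (hopfX q) v1 v2 v3 =
      -Matrix.det !![fderiv ℝ mu1 q v1, fderiv ℝ mu1 q v2, fderiv ℝ mu1 q v3;
                      fderiv ℝ mu2 q v1, fderiv ℝ mu2 q v2, fderiv ℝ mu2 q v3;
                      fderiv ℝ mu3 q v1, fderiv ℝ mu3 q v2, fderiv ℝ mu3 q v3] := by
    rw [hn]
    simp only [e1, e2, e3]
    simp [-smul_add, vol4, hopfX, i0, i1, i2, i3, dx1, dx2, dx3, dx4, Matrix.det_succ_row_zero, Fin.sum_univ_succ,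
      Fin.succAbove, Matrix.det_fin_three]
    ring
  rw [neg_mul, ← mul_neg, ← key, inv_mul_cancel_left₀ h0]
end
end

section
/- Gibbons–Hawking closedness lemma: let U ⊆ ℝ³ be open, f : U → ℝ smooth, and a a smooth 1-form on U whose exterior derivative satisfies da(v,w) = df(v × w) for all v, w ∈ ℝ³ (i.e. da = *_{ℝ³}df). Then on U × ℝ (with coordinate t on the ℝ factor, pulling back f, a and the coordinates x₁, x₂, x₃ from U), each of the 2-forms ω₁ = (dt + a)∧dx₁ − f·dx₂∧dx₃, ω₂ = (dt + a)∧dx₂ − f·dx₃∧dx₁, ω₃ = (dt + a)∧dx₃ − f·dx₁∧dx₂ is closed, where the exterior derivative of a 2-form field is defined as the alternation of its Fréchet derivative. -/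
noncomputable section

/-- The standard cross product on `ℝ³`. -/
def cross3 (v w : Fin 3 → ℝ) : Fin 3 → ℝ :=
  ![v 1 * w 2 - v 2 * w 1, v 2 * w 0 - v 0 * w 2, v 0 * w 1 - v 1 * w 0]

/-- The Gibbons–Hawking 2-forms `ω₁, ω₂, ω₃` on `U × ℝ` (with coordinate `t` on the `ℝ`
factor), `ω_i = (dt + a)∧dx_i − f·dx_j∧dx_k` for `(i,j,k)` a cyclic permutation of
`(1,2,3)`, where `f`, `a` and the coordinates `x₁, x₂, x₃` are pulled back from `U`. -/
def ghForm (f : (Fin 3 → ℝ) → ℝ) (a : (Fin 3 → ℝ) → (Fin 3 → ℝ) →L[ℝ] ℝ) (i : Fin 3)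
    (z : (Fin 3 → ℝ) × ℝ) (v w : (Fin 3 → ℝ) × ℝ) : ℝ :=
  (v.2 + a z.1 v.1) * w.1 i - (w.2 + a z.1 w.1) * v.1 i -
    f z.1 * (v.1 (i + 1) * w.1 (i + 2) - w.1 (i + 1) * v.1 (i + 2))

/-- Gibbons–Hawking closedness lemma: if `U ⊆ ℝ³` is open, `f : U → ℝ` is smooth, and
`a` is a smooth 1-form on `U` with `da(v,w) = df(v × w)` (i.e. `da = *_{ℝ³}df`), then
each of the 2-forms `ω₁, ω₂, ω₃` on `U × ℝ` is closed, where the exterior derivative of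
a 2-form field is the alternation of its Fréchet derivative. -/
theorem gibbons_hawking_forms_closed (U : Set (Fin 3 → ℝ)) (hU : IsOpen U)
    (f : (Fin 3 → ℝ) → ℝ) (a : (Fin 3 → ℝ) → (Fin 3 → ℝ) →L[ℝ] ℝ)
    (hf : ContDiffOn ℝ (⊤ : ℕ∞) f U) (ha : ContDiffOn ℝ (⊤ : ℕ∞) a U)
    (monopole : ∀ p ∈ U, ∀ v w : Fin 3 → ℝ,
      fderiv ℝ (fun z => a z w) p v - fderiv ℝ (fun z => a z v) p w =
        fderiv ℝ f p (cross3 v w)) :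
    ∀ i : Fin 3, ∀ z : (Fin 3 → ℝ) × ℝ, z.1 ∈ U →
      ∀ v0 v1 v2 : (Fin 3 → ℝ) × ℝ,
        fderiv ℝ (fun y => ghForm f a i y v1 v2) z v0 -
          fderiv ℝ (fun y => ghForm f a i y v0 v2) z v1 +
          fderiv ℝ (fun y => ghForm f a i y v0 v1) z v2 = 0 := by
  intro i z hz v0 v1 v2
  have hfd : DifferentiableAt ℝ f z.1 :=
    (hf.contDiffAt (hU.mem_nhds hz)).differentiableAt (by simp)
  have had : DifferentiableAt ℝ a z.1 :=
    (ha.contDiffAt (hU.mem_nhds hz)).differentiableAt (by simp)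
  have key : ∀ v w u : (Fin 3 → ℝ) × ℝ, fderiv ℝ (fun y => ghForm f a i y v w) z u =
      fderiv ℝ (fun y => a y v.1) z.1 u.1 * w.1 i - fderiv ℝ (fun y => a y w.1) z.1 u.1 * v.1 i
      - fderiv ℝ f z.1 u.1 * (v.1 (i + 1) * w.1 (i + 2) - w.1 (i + 1) * v.1 (i + 2)) := by
    intro v w u
    have hA : ∀ x : Fin 3 → ℝ, HasFDerivAt (fun y : (Fin 3 → ℝ) × ℝ => a y.1 x)
        ((fderiv ℝ (fun y => a y x) z.1).comp (ContinuousLinearMap.fst ℝ (Fin 3 → ℝ) ℝ)) z := by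
      intro x
      have h : DifferentiableAt ℝ (fun y => a y x) z.1 :=
        had.clm_apply (differentiableAt_const x)
      exact h.hasFDerivAt.comp z hasFDerivAt_fst
    have hF : HasFDerivAt (fun y : (Fin 3 → ℝ) × ℝ => f y.1)
        ((fderiv ℝ f z.1).comp (ContinuousLinearMap.fst ℝ (Fin 3 → ℝ) ℝ)) z :=
      hfd.hasFDerivAt.comp z hasFDerivAt_fst
    have h := ((((hA v.1).const_add v.2).mul_const (w.1 i)).sub
      (((hA w.1).const_add w.2).mul_const (v.1 i))).sub
      (hF.mul_const (v.1 (i + 1) * w.1 (i + 2) - w.1 (i + 1) * v.1 (i + 2)))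
    have h2 : HasFDerivAt (fun y => ghForm f a i y v w) _ z := h
    rw [h2.fderiv]
    simp
    ring
  have m01 := monopole z.1 hz v0.1 v1.1
  have m02 := monopole z.1 hz v0.1 v2.1
  have m12 := monopole z.1 hz v1.1 v2.1
  have lin : ∀ x : Fin 3 → ℝ, fderiv ℝ f z.1 x =
      x 0 * fderiv ℝ f z.1 (Pi.single 0 1) + x 1 * fderiv ℝ f z.1 (Pi.single 1 1)
      + x 2 * fderiv ℝ f z.1 (Pi.single 2 1) := by
    intro x
    conv_lhs => rw [pi_eq_sum_univ' x]
    simp [Fin.sum_univ_three]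
  rw [key, key, key]
  rw [lin (cross3 _ _)] at m01 m02 m12
  rw [lin v0.1, lin v1.1, lin v2.1]
  simp only [cross3, Matrix.cons_val] at m01 m02 m12
  fin_cases i
  · simp
    linear_combination v2.1 0 * m01 - v1.1 0 * m02 + v0.1 0 * m12
  · simp
    linear_combination v2.1 1 * m01 - v1.1 1 * m02 + v0.1 1 * m12
  · simp
    linear_combination v2.1 2 * m01 - v1.1 2 * m02 + v0.1 2 * m12
end
end

section
/- The flat Spin(7) 4-form Ψ on ℍ² is invariant under diagonal right multiplication by unit complex numbers: for every θ ∈ ℝ, setting u = cos θ + sin θ·i, one has Ψ(v¹·u, v²·u, v³·u, v⁴·u) = Ψ(v¹, v², v³, v⁴) for all v¹,…,v⁴ ∈ ℍ², where v·u denotes (v₁·u, v₂·u). In particular Ψ is invariant under the circle action generated by diagonal right multiplication by i (the vector field Y of the paper). -/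
noncomputable section

def qJ : Quaternion ℝ := ⟨0, 0, 1, 0⟩
def qK : Quaternion ℝ := ⟨0, 0, 0, 1⟩

/-- The bilinear form `B_a((p₁,p₂),(v₁,v₂)) = Re(conj(v₁)·p₁·a) + Re(conj(v₂)·p₂·a)`
on `ℍ²`. -/
def Bq (a : Quaternion ℝ) (p v : Quaternion ℝ × Quaternion ℝ) : ℝ :=
  (star v.1 * p.1 * a).re + (star v.2 * p.2 * a).re

/-- The constant alternating 2-form `β_a(v,w) = B_a(v,w) − B_a(w,v)` (the exterior
derivative `dα_a` of the linear 1-form `α_a|_p = B_a(p,·)`). -/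
def betaQ (a : Quaternion ℝ) (v w : Quaternion ℝ × Quaternion ℝ) : ℝ :=
  Bq a v w - Bq a w v

/-- The wedge product of two (alternating) 2-forms on `ℍ²`, evaluated by the standard
(2,2)-shuffle formula. -/
def wedge22 (α β : Quaternion ℝ × Quaternion ℝ → Quaternion ℝ × Quaternion ℝ → ℝ)
    (v0 v1 v2 v3 : Quaternion ℝ × Quaternion ℝ) : ℝ :=
  α v0 v1 * β v2 v3 - α v0 v2 * β v1 v3 + α v0 v3 * β v1 v2 +
    α v1 v2 * β v0 v3 - α v1 v3 * β v0 v2 + α v2 v3 * β v0 v1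

/-- The flat `Spin(7)` 4-form `Ψ = (1/8)(−β_i∧β_i + β_j∧β_j + β_k∧β_k)` on `ℍ²`. -/
def PsiQ (v0 v1 v2 v3 : Quaternion ℝ × Quaternion ℝ) : ℝ :=
  (1 / 8 : ℝ) * (-(wedge22 (betaQ qI) (betaQ qI) v0 v1 v2 v3) +
    wedge22 (betaQ qJ) (betaQ qJ) v0 v1 v2 v3 +
    wedge22 (betaQ qK) (betaQ qK) v0 v1 v2 v3)

theorem betaI_rot (θ : ℝ) (v w : Quaternion ℝ × Quaternion ℝ) :
    betaQ qI (v.1 * unitC θ, v.2 * unitC θ) (w.1 * unitC θ, w.2 * unitC θ) =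
      (Real.cos θ ^ 2 + Real.sin θ ^ 2) * betaQ qI v w := by
  simp only [betaQ, Bq, Quaternion.re_mul, Quaternion.imI_mul, Quaternion.imJ_mul,
    Quaternion.imK_mul, Quaternion.re_star, Quaternion.imI_star, Quaternion.imJ_star,
    Quaternion.imK_star]
  simp only [qI, qJ, qK, unitC]
  ring

theorem betaJ_rot (θ : ℝ) (v w : Quaternion ℝ × Quaternion ℝ) :
    betaQ qJ (v.1 * unitC θ, v.2 * unitC θ) (w.1 * unitC θ, w.2 * unitC θ) =
      (Real.cos θ ^ 2 - Real.sin θ ^ 2) * betaQ qJ v w +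
        2 * Real.cos θ * Real.sin θ * betaQ qK v w := by
  simp only [betaQ, Bq, Quaternion.re_mul, Quaternion.imI_mul, Quaternion.imJ_mul,
    Quaternion.imK_mul, Quaternion.re_star, Quaternion.imI_star, Quaternion.imJ_star,
    Quaternion.imK_star]
  simp only [qI, qJ, qK, unitC]
  ring

theorem betaK_rot (θ : ℝ) (v w : Quaternion ℝ × Quaternion ℝ) :
    betaQ qK (v.1 * unitC θ, v.2 * unitC θ) (w.1 * unitC θ, w.2 * unitC θ) =
      (Real.cos θ ^ 2 - Real.sin θ ^ 2) * betaQ qK v w -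
        2 * Real.cos θ * Real.sin θ * betaQ qJ v w := by
  simp only [betaQ, Bq, Quaternion.re_mul, Quaternion.imI_mul, Quaternion.imJ_mul,
    Quaternion.imK_mul, Quaternion.re_star, Quaternion.imI_star, Quaternion.imJ_star,
    Quaternion.imK_star]
  simp only [qI, qJ, qK, unitC]
  ring

/-- The flat `Spin(7)` 4-form `Ψ` on `ℍ²` is invariant under diagonal right
multiplication by unit complex numbers `u = cos θ + sin θ·i`; in particular `Ψ` is
invariant under the circle action generated by diagonal right multiplication by `i`
(the vector field `Y` of the paper). -/
theorem flat_spin7_right_circle_invariance (θ : ℝ)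
    (v0 v1 v2 v3 : Quaternion ℝ × Quaternion ℝ) :
    PsiQ (v0.1 * unitC θ, v0.2 * unitC θ) (v1.1 * unitC θ, v1.2 * unitC θ)
        (v2.1 * unitC θ, v2.2 * unitC θ) (v3.1 * unitC θ, v3.2 * unitC θ) =
      PsiQ v0 v1 v2 v3 := by
  have hc : Real.cos θ ^ 2 = 1 - Real.sin θ ^ 2 := by
    linarith [Real.sin_sq_add_cos_sq θ]
  have key : ∀ x y z w : ℝ,
      (((Real.cos θ ^ 2 - Real.sin θ ^ 2) * x + 2 * Real.cos θ * Real.sin θ * y) *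
        ((Real.cos θ ^ 2 - Real.sin θ ^ 2) * z + 2 * Real.cos θ * Real.sin θ * w)) =
      x * z + y * w - ((Real.cos θ ^ 2 - Real.sin θ ^ 2) * y - 2 * Real.cos θ * Real.sin θ * x) *
        ((Real.cos θ ^ 2 - Real.sin θ ^ 2) * w - 2 * Real.cos θ * Real.sin θ * z) := by
    intro x y z w
    have h : (Real.cos θ ^ 2 + Real.sin θ ^ 2) ^ 2 = 1 := by rw [hc]; ring
    linear_combination (x * z + y * w) * h
  simp only [PsiQ, wedge22, betaI_rot, betaJ_rot, betaK_rot, key, Real.cos_sq_add_sin_sq]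
  ring
end
end

section
/- The 3-form obtained by contracting the flat Spin(7)-form with the generator of the diagonal left circle action is closed: with X(p₁,p₂) = (i·p₁, i·p₂), for all v⁰, v¹, v², v³ ∈ ℍ² one has Σ_{m=0}^{3} (−1)^m · Ψ(X(v^m), v⁰, …, v̂^m, …, v³) = 0; equivalently, the 3-form field p ↦ ι_{X(p)}Ψ on ℝ⁸ has vanishing exterior derivative (exterior derivative defined as the alternation of the Fréchet derivative). This is the closedness of the quotient G₂-structure φ = ι_X Φ₀. -/
noncomputable section

/-- The generator `X(p₁,p₂) = (i·p₁, i·p₂)` of the diagonal left circle action. -/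
def Xdiag (p : Quaternion ℝ × Quaternion ℝ) : Quaternion ℝ × Quaternion ℝ :=
  (qI * p.1, qI * p.2)

theorem betaQ_antisymm (a : Quaternion ℝ) (v w : Quaternion ℝ × Quaternion ℝ) :
    betaQ a w v = -betaQ a v w := by
  unfold betaQ; ring

theorem Bq_Xdiag (a : Quaternion ℝ) (v w : Quaternion ℝ × Quaternion ℝ) :
    Bq a (Xdiag v) w = -Bq a v (Xdiag w) := by
  have h : star qI = -qI := Quaternion.star_eq_neg.mpr rfl
  simp only [Bq, Xdiag, star_mul, h, mul_neg, neg_mul, mul_assoc, Quaternion.re_neg]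
  ring

theorem betaQ_Xdiag_symm (a : Quaternion ℝ) (v w : Quaternion ℝ × Quaternion ℝ) :
    betaQ a (Xdiag w) v = betaQ a (Xdiag v) w := by
  unfold betaQ
  rw [Bq_Xdiag a v w, Bq_Xdiag a w v]; ring

theorem wedge_closed (a : Quaternion ℝ) (v0 v1 v2 v3 : Quaternion ℝ × Quaternion ℝ) :
    wedge22 (betaQ a) (betaQ a) (Xdiag v0) v1 v2 v3
      - wedge22 (betaQ a) (betaQ a) (Xdiag v1) v0 v2 v3
      + wedge22 (betaQ a) (betaQ a) (Xdiag v2) v0 v1 v3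
      - wedge22 (betaQ a) (betaQ a) (Xdiag v3) v0 v1 v2 = 0 := by
  unfold wedge22
  rw [betaQ_Xdiag_symm a v0 v1, betaQ_Xdiag_symm a v0 v2, betaQ_Xdiag_symm a v0 v3,
    betaQ_Xdiag_symm a v1 v2, betaQ_Xdiag_symm a v1 v3, betaQ_Xdiag_symm a v2 v3]
  ring

/-- The 3-form obtained by contracting the flat `Spin(7)`-form with the generator of
the diagonal left circle action is closed: for all `v⁰, v¹, v², v³ ∈ ℍ²`,
`Σ_{m=0}^{3} (−1)^m·Ψ(X(v^m), v⁰, …, v̂^m, …, v³) = 0`; equivalently the 3-form field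
`p ↦ ι_{X(p)}Ψ` has vanishing exterior derivative (defined as the alternation of the
Fréchet derivative). This is the closedness of the quotient `G₂`-structure
`φ = ι_X Φ₀`. -/
theorem contraction_flat_spin7_closed (v0 v1 v2 v3 : Quaternion ℝ × Quaternion ℝ) :
    PsiQ (Xdiag v0) v1 v2 v3 - PsiQ (Xdiag v1) v0 v2 v3 +
      PsiQ (Xdiag v2) v0 v1 v3 - PsiQ (Xdiag v3) v0 v1 v2 = 0 := by
  unfold PsiQ
  linear_combination (1 / 8 : ℝ) * (-(wedge_closed qI v0 v1 v2 v3)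
    + wedge_closed qJ v0 v1 v2 v3 + wedge_closed qK v0 v1 v2 v3)
end
end
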